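/- Let Φ : 𝒜 → ℬ be a unital positive (not necessarily linear) map between unital C*-algebras with Φ(0) = 0 that enjoys property 𝒟_m for some m ≥ 3. Then for all self-adjoint A, B ∈ 𝒜 one has ‖Var_Φ(A)‖·Var_Φ(B) ≥ |Φ((1/2)[A,B])|² and ‖Var_Φ(B)‖·Var_Φ(A) ≥ |Φ((1/2)[A,B])|². In particular, if ℬ is commutative, then Var_Φ(A)·Var_Φ(B) ≥ |Φ((1/2)[A,B])|². -/

import Mathlib

/-- An element of a C*-algebra is positive if and only if it is of the form `star b * b`. -/
def IsPosElem {A : Type*} [Mul A] [Star A] (a : A) : Prop := ∃ b : A, a = star b * b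

/-- A (not necessarily linear) map `Φ : A → B` is `n`-positive if the entrywise induced map
on `n × n` matrices sends positive matrices to positive matrices. -/
def IsNPosMap {A B : Type*} [NonUnitalNonAssocSemiring A] [Star A]
    [NonUnitalNonAssocSemiring B] [Star B] (n : ℕ) (Φ : A → B) : Prop :=
  ∀ M : Matrix (Fin n) (Fin n) A, IsPosElem M → IsPosElem (M.map Φ)

universe v

/-- A unital positive map `Φ` enjoys property `𝒟_m` if it factors as `Φ = φ ∘ ψ` where
`ψ` is a unital positive linear map into some `C(Ω)` (`Ω` compact Hausdorff) and
`φ : C(Ω) → ℬ` is a unital `m`-positive map. -/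
def PropertyD {𝒜 ℬ : Type*} [CStarAlgebra 𝒜] [CStarAlgebra ℬ] (m : ℕ) (Φ : 𝒜 → ℬ) : Prop :=
  ∃ (Ω : Type v) (_ : TopologicalSpace Ω) (_ : CompactSpace Ω) (_ : T2Space Ω)
    (ψ : 𝒜 →ₗ[ℂ] C(Ω, ℂ)) (φ : C(Ω, ℂ) → ℬ),
    ψ 1 = 1 ∧ (∀ a : 𝒜, IsPosElem a → IsPosElem (ψ a)) ∧
    φ 1 = 1 ∧ IsNPosMap m φ ∧ ∀ a : 𝒜, Φ a = φ (ψ a)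


theorem pos_gen {D : Type*} [CStarAlgebra D] (a : D) (ha : star a = a)
    (h : ∀ s : ℝ, 0 < s → IsUnit (a + algebraMap ℝ D s)) : ∃ b : D, a = star b * b := by
  let _ := CStarAlgebra.spectralOrder D
  have := CStarAlgebra.spectralOrderedRing D
  have hsa : IsSelfAdjoint a := ha
  have hnn : 0 ≤ a := by
    rw [StarOrderedRing.nonneg_iff_spectrum_nonneg (R := ℝ) a hsa]
    intro x hx
    by_contra hneg
    push Not at hneg
    apply hx
    have h2 := (h (-x) (by linarith)).neg
    show IsUnit (algebraMap ℝ D x - a)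
    convert h2 using 1
    simp [sub_eq_add_neg, add_comm]
  exact CStarAlgebra.nonneg_iff_eq_star_mul_self.mp hnn

theorem matrix_pos_gen {C : Type*} [CStarAlgebra C]
    (M : Matrix (Fin 3) (Fin 3) C) (hM : star M = M)
    (h : ∀ s : ℝ, 0 < s → IsUnit (M + Matrix.diagonal (fun _ => algebraMap ℝ C s))) :
    IsPosElem M := by
  let _ := CStarAlgebra.spectralOrder C
  have := CStarAlgebra.spectralOrderedRing C
  obtain ⟨N, hN⟩ := pos_gen (D := CStarMatrix (Fin 3) (Fin 3) C) (CStarMatrix.ofMatrix M) hM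
    (by
      intro s hs
      have h2 := ((h s hs).map (CStarMatrix.ofMatrixRingEquiv (n := Fin 3) (A := C)))
      convert h2 using 1
      ext i j
      show M i j + (algebraMap ℝ (Matrix (Fin 3) (Fin 3) C) s) i j = (M i j +
        (Matrix.diagonal (fun _ => algebraMap ℝ C s) : Matrix (Fin 3) (Fin 3) C) i j)
      rw [Matrix.algebraMap_eq_diagonal]
      rfl)
  exact ⟨CStarMatrix.ofMatrix.symm N, hN⟩

theorem matrix_pos_aux {Ω : Type*} [TopologicalSpace Ω] [CompactSpace Ω]
    (M : Matrix (Fin 3) (Fin 3) C(Ω, ℂ)) (hM : star M = M)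
    (h : ∀ s : ℝ, 0 < s → ∀ ω : Ω, (Matrix.det (M + Matrix.diagonal
      (fun _ => algebraMap ℝ C(Ω, ℂ) s)) : C(Ω, ℂ)) ω ≠ 0) :
    IsPosElem M := by
  refine matrix_pos_gen M hM fun s hs => ?_
  have h1 := h s hs
  rw [← ContinuousMap.isUnit_iff_forall_ne_zero, ← Matrix.isUnit_iff_isUnit_det] at h1
  exact h1

theorem npos_three {R ℬ : Type*} [CommRing R] [StarRing R] [NonUnitalSemiring ℬ] [StarRing ℬ]
    (m : ℕ) (hm : 3 ≤ m) (φ : R → ℬ) (hφ : IsNPosMap m φ)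
    (M : Matrix (Fin 3) (Fin 3) R) (hM : IsPosElem M) :
    ∃ S : Fin m → Fin 3 → ℬ, ∀ i j, φ (M i j) = ∑ k, star (S k i) * S k j := by
  obtain ⟨N, hN⟩ := hM
  let E : Matrix (Fin m) (Fin 3) R := Matrix.of fun i j => if i = Fin.castLE hm j then 1 else 0
  have hE : Matrix.conjTranspose E * E = 1 := by
    ext i j
    simp only [Matrix.mul_apply, Matrix.conjTranspose_apply, Matrix.of_apply, E, Matrix.one_apply]
    simp [apply_ite star, Fin.castLE_inj, eq_comm]
  have hpos : IsPosElem (E * M * Matrix.conjTranspose E) := by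
    refine ⟨E * N * Matrix.conjTranspose E, ?_⟩
    rw [hN, Matrix.star_eq_conjTranspose, Matrix.star_eq_conjTranspose, Matrix.conjTranspose_mul,
      Matrix.conjTranspose_mul, Matrix.conjTranspose_conjTranspose]
    calc _ = E * (N.conjTranspose * 1 * N) * E.conjTranspose := by rw [Matrix.mul_one]
      _ = _ := by rw [← hE]; simp only [Matrix.mul_assoc]
  obtain ⟨S, hS⟩ := hφ _ hpos
  refine ⟨fun k i => S k (Fin.castLE hm i), fun i j => ?_⟩
  have h1 : (E * M * Matrix.conjTranspose E) (Fin.castLE hm i) (Fin.castLE hm j) = M i j := by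
    simp only [Matrix.mul_apply, Matrix.conjTranspose_apply, Matrix.of_apply, E]
    simp [apply_ite star, Fin.castLE_inj]
  have h2 := congrFun (congrFun hS (Fin.castLE hm i)) (Fin.castLE hm j)
  rw [Matrix.map_apply, h1] at h2
  rw [h2]
  simp [Matrix.mul_apply, Matrix.star_apply]

theorem npos_quad {R ℬ : Type*} [CommRing R] [StarRing R] [CStarAlgebra ℬ]
    [PartialOrder ℬ] [StarOrderedRing ℬ]
    (m : ℕ) (hm : 3 ≤ m) (φ : R → ℬ) (hφ : IsNPosMap m φ)
    (M : Matrix (Fin 3) (Fin 3) R) (hM : IsPosElem M) :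
    (∀ i j, star (φ (M i j)) = φ (M j i)) ∧
    ∀ v : Fin 3 → ℬ, 0 ≤ ∑ i, ∑ j, star (v i) * φ (M i j) * v j := by
  obtain ⟨S, hS⟩ := npos_three m hm φ hφ M hM
  constructor
  · intro i j
    simp [hS, star_sum]
  · intro v
    have : ∑ i, ∑ j, star (v i) * φ (M i j) * v j
        = ∑ k, star (∑ i, S k i * v i) * (∑ i, S k i * v i) := by
      simp only [hS, star_add, star_mul, Finset.mul_sum, Finset.sum_mul, Fin.sum_univ_three,
        ← Finset.sum_add_distrib]
      refine Finset.sum_congr rfl fun k _ => ?_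
      noncomm_ring
    rw [this]
    exact Finset.sum_nonneg fun k _ => star_mul_self_nonneg _

theorem state_real {𝒜 : Type*} [CStarAlgebra 𝒜] (f : 𝒜 →ₗ[ℂ] ℂ)
    (hf : ∀ x : 𝒜, 0 ≤ (f (star x * x)).re ∧ (f (star x * x)).im = 0) (A : 𝒜) (hA : star A = A) :
    (f A).im = 0 := by
  have h1 := (hf (A + 1)).2
  have h2 := (hf A).2
  have h3 := (hf 1).2
  simp only [star_add, star_one, hA, mul_add, add_mul, map_add, mul_one, one_mul, Complex.add_im] at h1 h2 h3
  linarith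

theorem state_heis {𝒜 : Type*} [CStarAlgebra 𝒜] (f : 𝒜 →ₗ[ℂ] ℂ) (hf1 : f 1 = 1)
    (hf : ∀ x : 𝒜, 0 ≤ (f (star x * x)).re ∧ (f (star x * x)).im = 0)
    (A B : 𝒜) (hA : star A = A) (hB : star B = B) :
    (f ((1 / 2 : ℂ) • (A * B - B * A))).re = 0 ∧
    (f ((1 / 2 : ℂ) • (A * B - B * A))).im ^ 2 ≤
      ((f (A * A)).re - (f A).re ^ 2) * ((f (B * B)).re - (f B).re ^ 2) := by
  have hc := state_real f hf (Complex.I • (A * B - B * A)) (by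
    simp [star_smul, hA, hB, star_sub]
    rw [← smul_neg, neg_sub])
  have ha := state_real f hf A hA
  have hb := state_real f hf B hB
  simp only [map_smul, map_sub, smul_eq_mul] at hc ⊢
  have hcr : (f (A * B)).re - (f (B * A)).re = 0 := by simpa using hc
  have hhalf : (1 / 2 : ℂ) = ((1 / 2 : ℝ) : ℂ) := by push_cast; rfl
  rw [hhalf, Complex.re_ofReal_mul, Complex.im_ofReal_mul]
  refine ⟨by simp [hcr], ?_⟩
  have key : ∀ s : ℝ, 0 ≤ ((f (B * B)).re - (f B).re ^ 2) * (s * s)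
      + (-((f (A * B)).im - (f (B * A)).im)) * s + ((f (A * A)).re - (f A).re ^ 2) := by
    intro s
    have h := (hf (A + ((s : ℂ) * Complex.I) • B + (-(f A) - (s : ℂ) * Complex.I * f B) • (1 : 𝒜))).1
    simp only [star_add, star_smul, star_one, hA, hB, mul_add, add_mul, map_add, mul_one, one_mul,
      smul_mul_assoc, mul_smul_comm, map_smul, smul_eq_mul, hf1, Complex.add_re, Complex.mul_re,
      Complex.mul_im, Complex.star_def, Complex.sub_re, Complex.sub_im, Complex.neg_re,
      Complex.neg_im, Complex.ofReal_re, Complex.ofReal_im, Complex.I_re, Complex.I_im,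
      Complex.conj_re, Complex.conj_im, ha, hb] at h
    nlinarith [h]
  have hd := discrim_le_zero key
  unfold discrim at hd
  simp only [Complex.sub_im]
  nlinarith [hd]

theorem mat1_pos {Ω : Type*} [TopologicalSpace Ω] [CompactSpace Ω] (a2 b2 a b c : C(Ω, ℂ))
    (ha2 : ∀ ω, (a2 ω).im = 0) (hb2 : ∀ ω, (b2 ω).im = 0) (ha : ∀ ω, (a ω).im = 0)
    (hb : ∀ ω, (b ω).im = 0) (hc : ∀ ω, (c ω).re = 0)
    (hp : ∀ ω, 0 ≤ (a2 ω).re - (a ω).re ^ 2) (hq : ∀ ω, 0 ≤ (b2 ω).re - (b ω).re ^ 2)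
    (h : ∀ ω, (c ω).im ^ 2 ≤ ((a2 ω).re - (a ω).re ^ 2) * ((b2 ω).re - (b ω).re ^ 2)) :
    IsPosElem (!![a2, c, a; star c, b2 - b * b, 0; a, 0, 1] : Matrix (Fin 3) (Fin 3) C(Ω, ℂ)) := by
  apply matrix_pos_aux
  · ext i j ω
    fin_cases i <;> fin_cases j <;>
      simp [Complex.ext_iff, Matrix.star_apply, ha2, hb2, ha, hb]
  · intro s hs ω
    obtain ⟨x, hx⟩ : ∃ x : ℝ, a2 ω = x := ⟨(a2 ω).re, by simp [Complex.ext_iff, ha2]⟩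
    obtain ⟨y, hy⟩ : ∃ x : ℝ, b2 ω = x := ⟨(b2 ω).re, by simp [Complex.ext_iff, hb2]⟩
    obtain ⟨u, hu⟩ : ∃ x : ℝ, a ω = x := ⟨(a ω).re, by simp [Complex.ext_iff, ha]⟩
    obtain ⟨v, hv⟩ : ∃ x : ℝ, b ω = x := ⟨(b ω).re, by simp [Complex.ext_iff, hb]⟩
    obtain ⟨r, hr⟩ : ∃ x : ℝ, c ω = x * Complex.I :=
      ⟨(c ω).im, by simp [Complex.ext_iff, hc]⟩
    have hp := hp ω
    have hq := hq ω
    have h := h ω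
    simp [hx, hy, hu, hv, hr] at hp hq h
    have hval : (Matrix.det (!![a2, c, a; star c, b2 - b * b, 0; a, 0, 1] + Matrix.diagonal
        (fun _ => algebraMap ℝ C(Ω, ℂ) s)) : C(Ω, ℂ)) ω =
        (((1 + s) * ((x - u ^ 2 + s) * (y - v ^ 2 + s) - r ^ 2)
          + u ^ 2 * (y - v ^ 2 + s) * s : ℝ) : ℂ) := by
      rw [Matrix.det_fin_three]
      simp [hx, hy, hu, hv, hr]
      ring_nf
      simp
      ring
    rw [hval, Complex.ofReal_ne_zero]
    apply ne_of_gt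
    have h1 : 0 < (x - u ^ 2 + s) * (y - v ^ 2 + s) - r ^ 2 := by nlinarith [mul_pos hs hs]
    have h2 : 0 ≤ u ^ 2 * (y - v ^ 2 + s) * s := by
      apply mul_nonneg (mul_nonneg (sq_nonneg _) (by linarith)) hs.le
    have h3 : 0 < (1 + s) * ((x - u ^ 2 + s) * (y - v ^ 2 + s) - r ^ 2) :=
      mul_pos (by linarith) h1
    linarith

theorem mat2_pos {Ω : Type*} [TopologicalSpace Ω] [CompactSpace Ω] (f g : C(Ω, ℂ))
    (hfi : ∀ ω, (f ω).im = 0) (hgi : ∀ ω, (g ω).im = 0)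
    (hf : ∀ ω, 0 ≤ (f ω).re) (hg : ∀ ω, 0 ≤ (g ω).re) :
    IsPosElem (!![f + g, f, g; f, f, 0; g, 0, g] : Matrix (Fin 3) (Fin 3) C(Ω, ℂ)) := by
  apply matrix_pos_aux
  · ext i j ω
    fin_cases i <;> fin_cases j <;>
      simp [Complex.ext_iff, Matrix.star_apply, hfi, hgi]
  · intro s hs ω
    obtain ⟨x, hx⟩ : ∃ x : ℝ, f ω = x := ⟨(f ω).re, by simp [Complex.ext_iff, hfi]⟩
    obtain ⟨y, hy⟩ : ∃ x : ℝ, g ω = x := ⟨(g ω).re, by simp [Complex.ext_iff, hgi]⟩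
    have hf := hf ω
    have hg := hg ω
    simp [hx, hy] at hf hg
    have hval : (Matrix.det (!![f + g, f, g; f, f, 0; g, 0, g] + Matrix.diagonal
        (fun _ => algebraMap ℝ C(Ω, ℂ) s)) : C(Ω, ℂ)) ω =
        (((x + y + s) * (x + s) * (y + s) - x ^ 2 * (y + s) - y ^ 2 * (x + s) : ℝ) : ℂ) := by
      rw [Matrix.det_fin_three]
      simp [hx, hy]
      ring_nf
    rw [hval, Complex.ofReal_ne_zero]
    apply ne_of_gt
    have : (x + y + s) * (x + s) * (y + s) - x ^ 2 * (y + s) - y ^ 2 * (x + s)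
      = x * s * (y + s) + y * s * (x + s) + s * (x + s) * (y + s) := by ring
    rw [this]
    positivity

theorem mat3_pos {R : Type*} [CommRing R] [StarRing R] (b : R) (hb : star b = b) :
    IsPosElem (!![b * b, b, 0; b, 1, 0; 0, 0, 0] : Matrix (Fin 3) (Fin 3) R) := by
  refine ⟨!![b, 1, 0; 0, 0, 0; 0, 0, 0], ?_⟩
  ext i j
  fin_cases i <;> fin_cases j <;>
    simp [Matrix.mul_apply, Fin.sum_univ_three, Matrix.star_apply, hb]

section order
variable {ℬ : Type*} [CStarAlgebra ℬ] [PartialOrder ℬ] [StarOrderedRing ℬ]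

theorem schur_bound (V γ q W : ℬ) (hWu : IsUnit W)
    (hW : 0 ≤ W) (hVW : V ≤ W) (hcomm : ∀ x, W * x = x * W)
    (hquad : ∀ u w : ℬ, 0 ≤ star u * V * u + star u * γ * w + star w * star γ * u
      + star w * q * w) : star γ * γ ≤ W * q := by
  obtain ⟨⟨W', Wi, h1, h2⟩, rfl⟩ := hWu
  simp only at hW hVW hcomm ⊢
  have hsW : star W' = W' := (IsSelfAdjoint.of_nonneg hW)
  have hsWi : star Wi = Wi := by
    have e1 : star Wi * W' = 1 := by rw [← hsW, ← star_mul, h1, star_one]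
    calc star Wi = star Wi * (W' * Wi) := by rw [h1, mul_one]
      _ = Wi := by rw [← mul_assoc, e1, one_mul]
  have k1 := hquad (-(Wi * γ)) 1
  have k2 : 0 ≤ star (Wi * γ) * (W' - V) * (Wi * γ) :=
    star_left_conjugate_nonneg (sub_nonneg.mpr hVW) _
  have k3 := add_nonneg k1 k2
  have e : star (-(Wi * γ)) * V * (-(Wi * γ)) + star (-(Wi * γ)) * γ * 1
      + star 1 * star γ * (-(Wi * γ)) + star 1 * q * 1 + star (Wi * γ) * (W' - V) * (Wi * γ)
      = q - star γ * Wi * γ := by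
    have : star (Wi * γ) * W' * (Wi * γ) = star γ * Wi * γ := by
      rw [star_mul, hsWi, mul_assoc (star γ), h2, mul_one, mul_assoc]
    rw [mul_sub, sub_mul, this]
    simp only [star_neg, star_mul, star_one, hsWi]
    noncomm_ring
  rw [e] at k3
  have k4 := Commute.mul_nonneg hW k3 (hcomm _)
  rw [mul_sub, sub_nonneg] at k4
  convert k4 using 1
  rw [← mul_assoc, ← mul_assoc, hcomm (star γ), mul_assoc (star γ), h1, mul_one]

theorem le_of_eps (x y q : ℬ) (h : ∀ ε : ℝ, 0 < ε → x ≤ y + ε • q) : x ≤ y := by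
  have ht : Filter.Tendsto (fun ε : ℝ => y + ε • q) (nhdsWithin 0 (Set.Ioi 0)) (nhds y) := by
    have : Continuous (fun ε : ℝ => y + ε • q) := by fun_prop
    have h2 := this.tendsto 0
    simp only [zero_smul, add_zero] at h2
    exact h2.mono_left nhdsWithin_le_nhds
  exact ge_of_tendsto ht (Filter.eventually_of_mem self_mem_nhdsWithin fun ε hε => h ε hε)

theorem isUnit_add_eps (V : ℬ) (hV : 0 ≤ V) (ε : ℝ) (hε : 0 < ε) :
    IsUnit (V + algebraMap ℝ ℬ ε) := by
  have h := (StarOrderedRing.nonneg_iff_spectrum_nonneg (R := ℝ) V (IsSelfAdjoint.of_nonneg hV)).1 hV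
  by_contra hu
  have h1 : -ε ∈ spectrum ℝ V := by
    intro h2
    apply hu
    have h3 : IsUnit (algebraMap ℝ ℬ (-ε) - V) := h2
    convert h3.neg using 1
    simp
  have := h _ h1
  linarith

theorem norm_bound (V γ q r : ℬ) (hV : 0 ≤ V) (hqr : q ≤ r)
    (hquad : ∀ u w : ℬ, 0 ≤ star u * V * u + star u * γ * w + star w * star γ * u
      + star w * q * w) : star γ * γ ≤ ‖V‖ • r := by
  refine le_trans (le_of_eps _ (‖V‖ • q) q fun ε hε => ?_) (smul_le_smul_of_nonneg_left hqr (norm_nonneg _))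
  have hpos : (0 : ℝ) < ‖V‖ + ε := by positivity
  have h0 : (0 : ℬ) ≤ algebraMap ℝ ℬ (‖V‖ + ε) := by
    rw [Algebra.algebraMap_eq_smul_one]
    exact smul_nonneg hpos.le zero_le_one
  have := schur_bound V γ q (algebraMap ℝ ℬ (‖V‖ + ε)) ((IsUnit.mk0 _ hpos.ne').map _) h0
    (by
      refine (IsSelfAdjoint.le_algebraMap_norm_self (IsSelfAdjoint.of_nonneg hV)).trans ?_
      rw [Algebra.algebraMap_eq_smul_one, Algebra.algebraMap_eq_smul_one]
      exact smul_le_smul_of_nonneg_right (by linarith) zero_le_one)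
    (fun x => Algebra.commutes _ x) hquad
  rwa [Algebra.algebraMap_eq_smul_one, smul_mul_assoc, one_mul, add_smul] at this

theorem comm_bound (V γ q r : ℬ) (hV : 0 ≤ V) (hqr : q ≤ r) (hcomm : ∀ x y : ℬ, x * y = y * x)
    (hquad : ∀ u w : ℬ, 0 ≤ star u * V * u + star u * γ * w + star w * star γ * u
      + star w * q * w) : star γ * γ ≤ V * r := by
  have h1 : V * q ≤ V * r := by
    rw [← sub_nonneg, ← mul_sub]
    exact Commute.mul_nonneg hV (sub_nonneg.mpr hqr) (hcomm _ _)
  refine le_trans (le_of_eps _ (V * q) q fun ε hε => ?_) h1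
  have h0 : (0 : ℬ) ≤ algebraMap ℝ ℬ ε := by
    rw [Algebra.algebraMap_eq_smul_one]
    exact smul_nonneg hε.le zero_le_one
  have := schur_bound V γ q (V + algebraMap ℝ ℬ ε) (isUnit_add_eps V hV ε hε) (add_nonneg hV h0)
    (le_add_of_nonneg_right h0) (fun x => hcomm _ x) hquad
  rwa [Algebra.algebraMap_eq_smul_one, add_mul, smul_mul_assoc, one_mul] at this

theorem core {Ω : Type*} [TopologicalSpace Ω] [CompactSpace Ω] (a2 b2 a b c : C(Ω, ℂ))
    (ha2 : ∀ ω, (a2 ω).im = 0) (hb2 : ∀ ω, (b2 ω).im = 0) (ha : ∀ ω, (a ω).im = 0)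
    (hb : ∀ ω, (b ω).im = 0) (hc : ∀ ω, (c ω).re = 0)
    (hp : ∀ ω, 0 ≤ (a2 ω).re - (a ω).re ^ 2) (hq : ∀ ω, 0 ≤ (b2 ω).re - (b ω).re ^ 2)
    (h : ∀ ω, (c ω).im ^ 2 ≤ ((a2 ω).re - (a ω).re ^ 2) * ((b2 ω).re - (b ω).re ^ 2))
    (m : ℕ) (hm : 3 ≤ m) (φ : C(Ω, ℂ) → ℬ) (hφ : IsNPosMap m φ) (h1 : φ 1 = 1) (h0 : φ 0 = 0) :
    ∃ q : ℬ, 0 ≤ φ a2 - φ a * φ a ∧ q ≤ φ b2 - φ b * φ b ∧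
      ∀ u w : ℬ, 0 ≤ star u * (φ a2 - φ a * φ a) * u + star u * φ c * w + star w * star (φ c) * u
      + star w * q * w := by
  obtain ⟨s1, p1⟩ := npos_quad m hm φ hφ _ (mat1_pos a2 b2 a b c ha2 hb2 ha hb hc hp hq h)
  obtain ⟨s2, p2⟩ := npos_quad m hm φ hφ _ (mat2_pos (b2 - b * b) (b * b)
    (by simp [hb2, hb]) (by simp [hb]) (by intro ω; simpa [hb, sq] using hq ω)
    (by intro ω; simpa [hb] using mul_self_nonneg _))
  obtain ⟨s3, p3⟩ := npos_quad m hm φ hφ _ (mat3_pos b (by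
    ext ω
    simp [Complex.ext_iff, hb]))
  have sa : star (φ a) = φ a := by simpa using s1 0 2
  have sc : star (φ c) = φ (star c) := by simpa using s1 0 1
  have sb : star (φ b) = φ b := by simpa using s3 0 1
  have quad : ∀ u w : ℬ, 0 ≤ star u * (φ a2 - φ a * φ a) * u + star u * φ c * w
      + star w * star (φ c) * u + star w * φ (b2 - b * b) * w := by
    intro u w
    have := p1 ![u, w, -(φ a * u)]
    simp [Fin.sum_univ_three, h0, h1, sa, ← sc] at this
    convert this using 1
    noncomm_ring
  refine ⟨φ (b2 - b * b), ?_, ?_, quad⟩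
  · simpa using quad 1 0
  · have t2 := p2 ![1, -1, -1]
    have t3 := p3 ![1, -φ b, 0]
    simp [Fin.sum_univ_three, h0, h1, sb] at t2 t3
    rw [← sub_nonneg]
    convert add_nonneg (sub_nonneg.mpr t2) (sub_nonneg.mpr t3) using 1
    noncomm_ring

end order

/-- Theorem 4.1 (iii): if `Φ : 𝒜 → ℬ` is unital positive with `Φ(0) = 0` and enjoys
property `𝒟_m` for some `m ≥ 3`, then for self-adjoint `A, B`:
`‖Var_Φ(A)‖·Var_Φ(B) ≥ |Φ((1/2)[A,B])|²` and `‖Var_Φ(B)‖·Var_Φ(A) ≥ |Φ((1/2)[A,B])|²`;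
in particular, if `ℬ` is commutative, then `Var_Φ(A)·Var_Φ(B) ≥ |Φ((1/2)[A,B])|²`. -/
theorem heisenberg_uncertainty_norm_bounds
    {𝒜 ℬ : Type*} [CStarAlgebra 𝒜] [CStarAlgebra ℬ]
    (Φ : 𝒜 → ℬ) (hunital : Φ 1 = 1)
    (hpos : ∀ a : 𝒜, IsPosElem a → IsPosElem (Φ a)) (h0 : Φ 0 = 0)
    (m : ℕ) (hm : 3 ≤ m) (hD : PropertyD.{v} m Φ)
    (A B : 𝒜) (hA : star A = A) (hB : star B = B) :
    IsPosElem (((‖Φ (A * A) - Φ A * Φ A‖ : ℝ) : ℂ) • (Φ (B * B) - Φ B * Φ B) -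
        star (Φ ((1 / 2 : ℂ) • (A * B - B * A))) * Φ ((1 / 2 : ℂ) • (A * B - B * A))) ∧
    IsPosElem (((‖Φ (B * B) - Φ B * Φ B‖ : ℝ) : ℂ) • (Φ (A * A) - Φ A * Φ A) -
        star (Φ ((1 / 2 : ℂ) • (A * B - B * A))) * Φ ((1 / 2 : ℂ) • (A * B - B * A))) ∧
    ((∀ x y : ℬ, x * y = y * x) →
      IsPosElem ((Φ (A * A) - Φ A * Φ A) * (Φ (B * B) - Φ B * Φ B) -
        star (Φ ((1 / 2 : ℂ) • (A * B - B * A))) * Φ ((1 / 2 : ℂ) • (A * B - B * A)))) := by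
  obtain ⟨Ω, _, _, _, ψ, φ, hψ1, hψ, hφ1, hφ, hΦ⟩ := hD
  let _ := CStarAlgebra.spectralOrder ℬ
  have := CStarAlgebra.spectralOrderedRing ℬ
  have hiff : ∀ x : ℬ, IsPosElem x ↔ 0 ≤ x := fun x =>
    CStarAlgebra.nonneg_iff_eq_star_mul_self.symm
  have hφ0 : φ 0 = 0 := by rw [← h0, hΦ, map_zero]
  let f : Ω → 𝒜 →ₗ[ℂ] ℂ := fun ω =>
    { toFun := fun x => ψ x ω
      map_add' := fun x y => by simp
      map_smul' := fun r x => by simp }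
  have hf1 : ∀ ω, f ω 1 = 1 := fun ω => by
    show ψ 1 ω = 1
    rw [hψ1]; rfl
  have hf : ∀ ω, ∀ x : 𝒜, 0 ≤ (f ω (star x * x)).re ∧ (f ω (star x * x)).im = 0 := by
    intro ω x
    obtain ⟨g, hg⟩ := hψ _ ⟨x, rfl⟩
    show 0 ≤ (ψ (star x * x) ω).re ∧ (ψ (star x * x) ω).im = 0
    rw [hg]
    simp only [ContinuousMap.mul_apply, ContinuousMap.star_apply, Complex.star_def,
      Complex.mul_re, Complex.mul_im, Complex.conj_re, Complex.conj_im]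
    constructor
    · nlinarith [mul_self_nonneg (g ω).re, mul_self_nonneg (g ω).im]
    · ring
  have hvar : ∀ ω, ∀ X : 𝒜, star X = X → 0 ≤ (f ω (X * X)).re - (f ω X).re ^ 2 := by
    intro ω X hX
    have hi := state_real (f ω) (hf ω) X hX
    have h := (hf ω (X - (f ω X) • (1 : 𝒜))).1
    simp only [star_sub, star_smul, star_one, hX, mul_sub, sub_mul, map_sub, mul_one, one_mul,
      smul_mul_assoc, mul_smul_comm, map_smul, smul_eq_mul, hf1, Complex.mul_re, Complex.mul_im,
      Complex.star_def, Complex.sub_re, Complex.sub_im, Complex.conj_re, Complex.conj_im, hi] at h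
    nlinarith [h]
  have hAi := fun ω => state_real (f ω) (hf ω) A hA
  have hBi := fun ω => state_real (f ω) (hf ω) B hB
  have hAAi := fun ω => state_real (f ω) (hf ω) (A * A) (by rw [star_mul, hA])
  have hBBi := fun ω => state_real (f ω) (hf ω) (B * B) (by rw [star_mul, hB])
  have hH := fun ω => state_heis (f ω) (hf1 ω) (hf ω) A B hA hB
  obtain ⟨q1, v1, l1, k1⟩ := core (ψ (A * A)) (ψ (B * B)) (ψ A) (ψ B)
    (ψ ((1 / 2 : ℂ) • (A * B - B * A))) hAAi hBBi hAi hBi (fun ω => (hH ω).1)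
    (fun ω => hvar ω A hA) (fun ω => hvar ω B hB) (fun ω => (hH ω).2) m hm φ hφ hφ1 hφ0
  obtain ⟨q2, v2, l2, k2⟩ := core (ψ (B * B)) (ψ (A * A)) (ψ B) (ψ A)
    (ψ ((1 / 2 : ℂ) • (A * B - B * A))) hBBi hAAi hBi hAi (fun ω => (hH ω).1)
    (fun ω => hvar ω B hB) (fun ω => hvar ω A hA)
    (fun ω => (hH ω).2.trans_eq (mul_comm _ _)) m hm φ hφ hφ1 hφ0
  rw [← hΦ, ← hΦ] at v1 l1 v2 l2
  simp only [← hΦ] at k1 k2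
  refine ⟨?_, ?_, fun hcomm => ?_⟩
  · rw [hiff, sub_nonneg, Complex.coe_smul]
    exact norm_bound _ _ _ _ v1 l1 k1
  · rw [hiff, sub_nonneg, Complex.coe_smul]
    exact norm_bound _ _ _ _ v2 l2 k2
  · rw [hiff, sub_nonneg]
    exact comm_bound _ _ _ _ v1 l1 hcomm k1
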